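/- For x > 0, ∑_{n=1}^∞ { J_n(x) Y_n(x) + 1/(πn) } = [ln(x/2) + γ]/π − (1/2) J₀(x) Y₀(x), where γ is the Euler–Mascheroni constant; the series converges. -/

import Mathlib

open MeasureTheory Real Filter Set Topology

noncomputable def besselJ (ν x : ℝ) : ℝ :=
  (x / 2) ^ ν * ∑' k : ℕ, (-1 : ℝ) ^ k * (x ^ 2 / 4) ^ k / (k.factorial * Real.Gamma (ν + k + 1))

noncomputable def besselY (ν x : ℝ) : ℝ :=
  limUnder (𝓝[{μ : ℝ | ∀ n : ℤ, μ ≠ (n : ℝ)}] ν)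
    (fun μ => (besselJ μ x * Real.cos (μ * Real.pi) - besselJ (-μ) x) / Real.sin (μ * Real.pi))

/-- The reciprocal of the real gamma function. -/
noncomputable def recipGamma (s : ℝ) : ℝ := (Real.Gamma s)⁻¹

theorem contDiff_recipGamma : ContDiff ℝ 1 recipGamma := by
  have h : ContDiff ℂ 1 (fun s : ℂ => (Complex.Gamma s)⁻¹) :=
    Complex.differentiable_one_div_Gamma.contDiff
  have h2 := h.real_of_complex
  convert! h2 using 2 with s
  rw [show recipGamma s = (Real.Gamma s)⁻¹ from rfl, Complex.Gamma_ofReal,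
    ← Complex.ofReal_inv, Complex.ofReal_re]

theorem hasDerivAt_recipGamma (s : ℝ) : HasDerivAt recipGamma (deriv recipGamma s) s :=
  (contDiff_recipGamma.differentiable one_ne_zero s).hasDerivAt

theorem recipGamma_eq_mul (s : ℝ) : recipGamma s = s * recipGamma (s + 1) := by
  rcases eq_or_ne s 0 with rfl | hs
  · simp [recipGamma]
  · rw [recipGamma, recipGamma, Real.Gamma_add_one hs, mul_inv, mul_inv_cancel_left₀ hs]

theorem deriv_recipGamma_eq (s : ℝ) :
    deriv recipGamma s = recipGamma (s + 1) + s * deriv recipGamma (s + 1) := by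
  have h1 := (hasDerivAt_id s).mul
    ((hasDerivAt_recipGamma (s + 1)).comp s ((hasDerivAt_id s).add_const 1))
  have h3 := h1.congr_of_eventuallyEq (f₁ := recipGamma) (Eventually.of_forall recipGamma_eq_mul)
  rw [h3.deriv]
  simp

theorem recipGamma_natCast_add_one (n : ℕ) : recipGamma (n + 1) = (n.factorial : ℝ)⁻¹ := by
  rw [recipGamma, Real.Gamma_nat_eq_factorial]

theorem recipGamma_neg_natCast (n : ℕ) : recipGamma (-n) = 0 := by
  rw [recipGamma, Real.Gamma_neg_nat_eq_zero, inv_zero]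

theorem deriv_recipGamma_one : deriv recipGamma 1 = Real.eulerMascheroniConstant := by
  have h := Real.hasDerivAt_Gamma_one.inv (by simp)
  rw [show recipGamma = Real.Gamma⁻¹ from rfl, h.deriv]
  simp

theorem deriv_recipGamma_neg_natCast (n : ℕ) :
    deriv recipGamma (-n) = (-1) ^ n * n.factorial := by
  induction n with
  | zero => simp [deriv_recipGamma_eq 0, recipGamma]
  | succ n ih =>
    rw [deriv_recipGamma_eq, show -((n + 1 : ℕ) : ℝ) + 1 = -n by push_cast; ring, ih,
      recipGamma_neg_natCast, Nat.factorial_succ]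
    push_cast
    ring

/-- The reciprocal gamma function and its derivative are bounded on right half-lines. -/
theorem exists_forall_abs_recipGamma_le (A : ℝ) :
    ∃ B, 1 ≤ B ∧ ∀ s, A ≤ s → |recipGamma s| ≤ B ∧ |deriv recipGamma s| ≤ B := by
  obtain ⟨B₁, h₁⟩ := (isCompact_Icc (a := min A 2) (b := 3)).exists_bound_of_continuousOn
    contDiff_recipGamma.continuous.continuousOn
  obtain ⟨B₂, h₂⟩ := (isCompact_Icc (a := min A 2) (b := 3)).exists_bound_of_continuousOn
    (contDiff_recipGamma.continuous_deriv le_rfl).continuousOn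
  simp only [Real.norm_eq_abs] at h₁ h₂
  set B := max 1 (max B₁ B₂)
  have key (m : ℕ) (s : ℝ) (hA : min A 2 ≤ s) (hm : s ≤ 3 + m) :
      |recipGamma s| ≤ B ∧ |deriv recipGamma s| ≤ B := by
    induction m generalizing s with
    | zero =>
      have hs : s ∈ Set.Icc (min A 2) 3 := ⟨hA, by simpa using hm⟩
      exact ⟨(h₁ s hs).trans (by simp [B]), (h₂ s hs).trans (by simp [B])⟩
    | succ m ih =>
      rcases le_or_gt s 3 with h3 | h3
      · have hs : s ∈ Set.Icc (min A 2) 3 := ⟨hA, h3⟩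
        exact ⟨(h₁ s hs).trans (by simp [B]), (h₂ s hs).trans (by simp [B])⟩
      push_cast at hm
      obtain ⟨ih₁, ih₂⟩ := ih (s - 1) ((min_le_right A 2).trans (by linarith)) (by linarith)
      have e₁ := recipGamma_eq_mul (s - 1)
      have e₂ := deriv_recipGamma_eq (s - 1)
      rw [sub_add_cancel] at e₁ e₂
      rw [abs_le] at ih₁ ih₂
      have b₁ : |recipGamma s| ≤ B / 2 := by
        rw [abs_le]; constructor <;> nlinarith
      rw [abs_le] at b₁
      refine ⟨abs_le.2 ⟨by linarith, by linarith⟩, abs_le.2 ⟨by nlinarith, by nlinarith⟩⟩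
  refine ⟨B, le_max_left _ _, fun s hs => ?_⟩
  obtain ⟨m, hm⟩ := exists_nat_ge (s - 3)
  exact key m s ((min_le_left A 2).trans hs) (by linarith)

/-- The exponential generating series `∑ aₖ (-w)ᵏ / k!`. -/
noncomputable def alternatingExpSeries (a : ℕ → ℝ) (w : ℝ) : ℝ :=
  ∑' k, a k * ((-w) ^ k / k.factorial)

section alternatingExpSeries

variable {a : ℕ → ℝ} {C : ℝ}

theorem norm_mul_pow_div_factorial_le (ha : ∀ k, |a k| ≤ C) (w : ℝ) (k : ℕ) :
    ‖a k * ((-w) ^ k / k.factorial)‖ ≤ C * (|w| ^ k / k.factorial) := by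
  rw [norm_mul, norm_div, norm_pow, norm_neg, Real.norm_eq_abs, Real.norm_eq_abs,
    Real.norm_natCast]
  gcongr
  exact ha k

theorem summable_alternatingExpSeries (ha : ∀ k, |a k| ≤ C) (w : ℝ) :
    Summable fun k => a k * ((-w) ^ k / k.factorial) :=
  .of_norm_bounded ((Real.summable_pow_div_factorial |w|).mul_left C)
    (norm_mul_pow_div_factorial_le ha w)

theorem hasSum_alternatingExpSeries (ha : ∀ k, |a k| ≤ C) (w : ℝ) :
    HasSum (fun k => a k * ((-w) ^ k / k.factorial)) (alternatingExpSeries a w) :=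
  (summable_alternatingExpSeries ha w).hasSum

theorem abs_alternatingExpSeries_le (ha : ∀ k, |a k| ≤ C) (w : ℝ) :
    |alternatingExpSeries a w| ≤ C * Real.exp |w| := by
  have h : HasSum (fun k : ℕ => C * (|w| ^ k / k.factorial)) (C * Real.exp |w|) := by
    rw [Real.exp_eq_exp_ℝ]
    exact (NormedSpace.expSeries_div_hasSum_exp |w|).mul_left C
  exact tsum_of_norm_bounded h (norm_mul_pow_div_factorial_le ha w)

theorem succ_mul_pow_div_factorial (w : ℝ) (k : ℕ) :
    (k + 1) * (w ^ k / (k + 1).factorial) = w ^ k / k.factorial := by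
  rw [Nat.factorial_succ]
  push_cast
  field_simp

theorem hasSum_natCast_mul_alternatingExpSeries (ha : ∀ k, |a k| ≤ C) (w : ℝ) :
    HasSum (fun k : ℕ => k * a k * ((-w) ^ k / k.factorial))
      (-w * alternatingExpSeries (fun k => a (k + 1)) w) := by
  rw [← hasSum_nat_add_iff' 1]
  convert! (hasSum_alternatingExpSeries (fun k => ha (k + 1)) w).mul_left (-w) using 1
  · ext k
    rw [← succ_mul_pow_div_factorial (-w) k, pow_succ]
    push_cast
    ring
  · simp [alternatingExpSeries]

theorem hasDerivAt_alternatingExpSeries (ha : ∀ k, |a k| ≤ C) (w : ℝ) :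
    HasDerivAt (alternatingExpSeries a) (-alternatingExpSeries (fun k => a (k + 1)) w) w := by
  set R := |w| + 1
  have hC : 0 ≤ C := (abs_nonneg _).trans (ha 0)
  have hu : Summable fun k : ℕ => C * (k * (R ^ (k - 1) / k.factorial)) := by
    refine .mul_left C ?_
    rw [← summable_nat_add_iff 1]
    simpa [succ_mul_pow_div_factorial] using Real.summable_pow_div_factorial R
  have h := hasDerivAt_tsum_of_isPreconnected hu Metric.isOpen_ball
    (convex_ball (0 : ℝ) R).isPreconnected
    (g := fun k w => a k * ((-w) ^ k / k.factorial))
    (g' := fun k w => a k * (-(k * ((-w) ^ (k - 1) / k.factorial)))) (y := w) (y₀ := w)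
    (fun k y _ => by
      convert! ((((hasDerivAt_id y).neg.pow k).div_const (k.factorial : ℝ)).const_mul (a k)) using 2
      simp
      ring)
    (fun k y hy => by
      rw [mem_ball_zero_iff] at hy
      rw [norm_mul, norm_neg, norm_mul, norm_div, norm_pow, norm_neg, Real.norm_natCast,
        Real.norm_natCast, Real.norm_eq_abs]
      gcongr
      exact ha k)
    (by simp [R]) (summable_alternatingExpSeries ha w) (by simp [R])
  convert! h using 1
  have hs : Summable fun k => a k * (-(k * ((-w) ^ (k - 1) / k.factorial))) := by
    refine .of_norm_bounded hu fun k => ?_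
    rw [norm_mul, norm_neg, norm_mul, norm_div, norm_pow, norm_neg, Real.norm_natCast,
      Real.norm_natCast, Real.norm_eq_abs]
    gcongr
    · exact ha k
    · simp [R]
  rw [hs.tsum_eq_zero_add, alternatingExpSeries, ← tsum_neg]
  simp only [Nat.cast_zero, zero_mul, neg_zero, mul_zero, zero_add]
  refine tsum_congr fun k => ?_
  rw [← succ_mul_pow_div_factorial]
  push_cast
  simp

theorem alternatingExpSeries_zero : alternatingExpSeries a 0 = a 0 := by
  rw [alternatingExpSeries, tsum_eq_single 0]
  · simp
  · intro k hk
    simp [hk]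

end alternatingExpSeries

/-- The entire factor of `J_ν`, as a function of `w = x² / 4`. -/
noncomputable def besselSeries (ν w : ℝ) : ℝ :=
  alternatingExpSeries (fun k => recipGamma (ν + k + 1)) w

/-- The derivative of `besselSeries` with respect to the order. -/
noncomputable def besselSeriesDeriv (ν w : ℝ) : ℝ :=
  alternatingExpSeries (fun k => deriv recipGamma (ν + k + 1)) w

theorem exists_bound_recipGamma (ν : ℝ) :
    ∃ B, ∀ k : ℕ, |recipGamma (ν + k + 1)| ≤ B ∧ |deriv recipGamma (ν + k + 1)| ≤ B := by
  obtain ⟨B, -, hB⟩ := exists_forall_abs_recipGamma_le ν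
  exact ⟨B, fun k => hB _ (by linarith [k.cast_nonneg (α := ℝ)])⟩

theorem besselSeries_sub_one (ν w : ℝ) :
    besselSeries (ν - 1) w = ν * besselSeries ν w - w * besselSeries (ν + 1) w := by
  obtain ⟨B, hB⟩ := exists_bound_recipGamma ν
  have h := ((hasSum_alternatingExpSeries (fun k => (hB k).1) w).mul_left ν).add
    (hasSum_natCast_mul_alternatingExpSeries (fun k => (hB k).1) w)
  have e (k : ℕ) : ν + ((k + 1 : ℕ) : ℝ) + 1 = ν + 1 + k + 1 := by push_cast; ring
  simp only [e] at h
  rw [besselSeries, alternatingExpSeries, tsum_congr fun k => ?_, h.tsum_eq]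
  · simp only [besselSeries]
    ring
  · rw [recipGamma_eq_mul, show ν - 1 + k + 1 + 1 = ν + k + 1 by ring]
    ring

theorem besselSeriesDeriv_sub_one (ν w : ℝ) :
    besselSeriesDeriv (ν - 1) w =
      besselSeries ν w + ν * besselSeriesDeriv ν w - w * besselSeriesDeriv (ν + 1) w := by
  obtain ⟨B, hB⟩ := exists_bound_recipGamma ν
  have h := ((hasSum_alternatingExpSeries (fun k => (hB k).1) w).add
    ((hasSum_alternatingExpSeries (fun k => (hB k).2) w).mul_left ν)).add
    (hasSum_natCast_mul_alternatingExpSeries (fun k => (hB k).2) w)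
  have e (k : ℕ) : ν + ((k + 1 : ℕ) : ℝ) + 1 = ν + 1 + k + 1 := by push_cast; ring
  simp only [e] at h
  rw [besselSeriesDeriv, alternatingExpSeries, tsum_congr fun k => ?_, h.tsum_eq]
  · simp only [besselSeries, besselSeriesDeriv]
    ring
  · rw [deriv_recipGamma_eq, show ν - 1 + k + 1 + 1 = ν + k + 1 by ring]
    ring

theorem hasDerivAt_besselSeries (ν w : ℝ) :
    HasDerivAt (besselSeries ν) (-besselSeries (ν + 1) w) w := by
  obtain ⟨B, hB⟩ := exists_bound_recipGamma ν
  convert! hasDerivAt_alternatingExpSeries (fun k => (hB k).1) w using 2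
  rw [besselSeries]
  congr! 4 with k
  push_cast
  ring

theorem hasDerivAt_besselSeriesDeriv (ν w : ℝ) :
    HasDerivAt (besselSeriesDeriv ν) (-besselSeriesDeriv (ν + 1) w) w := by
  obtain ⟨B, hB⟩ := exists_bound_recipGamma ν
  convert! hasDerivAt_alternatingExpSeries (fun k => (hB k).2) w using 2
  rw [besselSeriesDeriv]
  congr! 4 with k
  push_cast
  ring

theorem hasDerivAt_besselSeries_order (ν w : ℝ) :
    HasDerivAt (fun ν => besselSeries ν w) (besselSeriesDeriv ν w) ν := by
  obtain ⟨B, -, hB⟩ := exists_forall_abs_recipGamma_le ν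
  obtain ⟨B', hB'⟩ := exists_bound_recipGamma ν
  refine hasDerivAt_tsum_of_isPreconnected
    ((Real.summable_pow_div_factorial |w|).mul_left B) Metric.isOpen_ball
    (convex_ball ν 1).isPreconnected
    (g := fun (k : ℕ) ν => recipGamma (ν + k + 1) * ((-w) ^ k / k.factorial))
    (g' := fun (k : ℕ) ν => deriv recipGamma (ν + k + 1) * ((-w) ^ k / k.factorial)) (y := ν)
    (y₀ := ν) (fun k y _ => ?_) (fun k y hy => ?_) (by simp)
    (summable_alternatingExpSeries (fun k => (hB' k).1) w) (by simp)
  · have := (hasDerivAt_recipGamma (y + k + 1)).comp y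
      (((hasDerivAt_id y).add_const (k : ℝ)).add_const 1)
    convert! this.mul_const _ using 1
    simp
  · rw [norm_mul, norm_div, norm_pow, norm_neg, Real.norm_eq_abs, Real.norm_eq_abs,
      Real.norm_natCast]
    gcongr
    refine (hB _ ?_).2
    rw [Metric.mem_ball, Real.dist_eq] at hy
    have := (abs_lt.1 hy).1
    linarith [k.cast_nonneg (α := ℝ)]

theorem besselJ_eq_mul_besselSeries (ν x : ℝ) :
    besselJ ν x = (x / 2) ^ ν * besselSeries ν (x ^ 2 / 4) := by
  rw [besselJ, besselSeries, alternatingExpSeries]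
  congr 1
  refine tsum_congr fun k => ?_
  rw [recipGamma, neg_pow (x ^ 2 / 4)]
  field_simp

/-- The derivative of `besselJ` with respect to the order. -/
noncomputable def besselJOrderDeriv (ν x : ℝ) : ℝ :=
  Real.log (x / 2) * besselJ ν x + (x / 2) ^ ν * besselSeriesDeriv ν (x ^ 2 / 4)

section

variable {x : ℝ}

theorem hasDerivAt_besselJ_order (hx : 0 < x) (ν : ℝ) :
    HasDerivAt (fun ν => besselJ ν x) (besselJOrderDeriv ν x) ν := by
  simp only [besselJOrderDeriv, besselJ_eq_mul_besselSeries]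
  convert! ((hasDerivAt_id ν).const_rpow (half_pos hx)).mul
    (hasDerivAt_besselSeries_order ν (x ^ 2 / 4)) using 1
  simp
  ring

theorem besselJ_sub_one (hx : 0 < x) (ν : ℝ) :
    besselJ (ν - 1) x = 2 * ν / x * besselJ ν x - besselJ (ν + 1) x := by
  simp only [besselJ_eq_mul_besselSeries, besselSeries_sub_one,
    Real.rpow_sub_one (half_pos hx).ne', Real.rpow_add_one (half_pos hx).ne']
  field_simp
  ring

theorem besselJOrderDeriv_sub_one (hx : 0 < x) (ν : ℝ) :
    besselJOrderDeriv (ν - 1) x =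
      2 / x * besselJ ν x + 2 * ν / x * besselJOrderDeriv ν x - besselJOrderDeriv (ν + 1) x := by
  simp only [besselJOrderDeriv, besselJ_sub_one hx, besselSeriesDeriv_sub_one,
    Real.rpow_sub_one (half_pos hx).ne', Real.rpow_add_one (half_pos hx).ne',
    besselJ_eq_mul_besselSeries ν]
  field_simp
  ring

theorem hasDerivAt_rpow_mul_comp_sq {g : ℝ → ℝ} {g' : ℝ} (hx : 0 < x) (ν : ℝ)
    (hg : HasDerivAt g (-g') (x ^ 2 / 4)) :
    HasDerivAt (fun x => (x / 2) ^ ν * g (x ^ 2 / 4))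
      (ν / x * ((x / 2) ^ ν * g (x ^ 2 / 4)) - (x / 2) ^ (ν + 1) * g') x := by
  have hd : HasDerivAt (fun x : ℝ => x ^ 2 / 4) (x / 2) x := by
    convert! (hasDerivAt_pow 2 x).div_const 4 using 1
    ring
  convert! (((hasDerivAt_id x).div_const 2).rpow_const (p := ν) (Or.inl (half_pos hx).ne')).mul
    (hg.comp x hd) using 1
  simp only [id, Function.comp, Real.rpow_sub_one (half_pos hx).ne',
    Real.rpow_add_one (half_pos hx).ne']
  field_simp
  ring

theorem hasDerivAt_besselJ (hx : 0 < x) (ν : ℝ) :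
    HasDerivAt (besselJ ν) (ν / x * besselJ ν x - besselJ (ν + 1) x) x := by
  have h := hasDerivAt_rpow_mul_comp_sq hx ν (hasDerivAt_besselSeries ν (x ^ 2 / 4))
  simp only [← besselJ_eq_mul_besselSeries] at h
  exact h

theorem hasDerivAt_besselJOrderDeriv (hx : 0 < x) (ν : ℝ) :
    HasDerivAt (besselJOrderDeriv ν)
      (besselJ ν x / x + ν / x * besselJOrderDeriv ν x - besselJOrderDeriv (ν + 1) x) x := by
  have hlog : HasDerivAt (fun x : ℝ => Real.log (x / 2)) (1 / x) x := by
    convert! ((hasDerivAt_id x).div_const 2).log (half_pos hx).ne' using 1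
    simp
    field_simp
  convert! (hlog.mul (hasDerivAt_besselJ hx ν)).add
    (hasDerivAt_rpow_mul_comp_sq hx ν (hasDerivAt_besselSeriesDeriv ν (x ^ 2 / 4))) using 1
  simp only [besselJOrderDeriv]
  ring

theorem besselJ_neg_natCast (hx : 0 < x) (n : ℕ) :
    besselJ (-n) x = (-1) ^ n * besselJ n x := by
  induction n using Nat.twoStepInduction with
  | zero => simp
  | one => simpa using besselJ_sub_one hx 0
  | more n ih₀ ih₁ =>
    have h₁ := besselJ_sub_one hx (-(n + 1 : ℕ))
    have h₂ := besselJ_sub_one hx (n + 1 : ℕ)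
    push_cast at *
    rw [show -((n : ℝ) + 1) - 1 = -(n + 2) by ring, show -((n : ℝ) + 1) + 1 = -n by ring,
      ih₀, ih₁] at h₁
    rw [show (n : ℝ) + 1 - 1 = n by ring, show (n : ℝ) + 1 + 1 = n + 2 by ring] at h₂
    rw [h₁, h₂]
    ring

theorem neBot_nhdsWithin_nonintegers (a : ℝ) : NeBot (𝓝[{μ : ℝ | ∀ n : ℤ, μ ≠ (n : ℝ)}] a) := by
  have h : {μ : ℝ | ∀ n : ℤ, μ ≠ (n : ℝ)} = (Set.range ((↑) : ℤ → ℝ))ᶜ := by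
    ext μ
    simp [eq_comm]
  rw [h, ← mem_closure_iff_nhdsWithin_neBot]
  exact (Set.countable_range _).dense_compl ℝ a

theorem besselY_natCast (hx : 0 < x) (n : ℕ) :
    besselY n x =
      (besselJOrderDeriv n x + (-1) ^ n * besselJOrderDeriv (-n) x) / Real.pi := by
  have := neBot_nhdsWithin_nonintegers n
  refine Tendsto.limUnder_eq ?_
  have hsq : ((-1 : ℝ) ^ n) * (-1) ^ n = 1 := by rw [← mul_pow]; simp
  have hmul : HasDerivAt (fun μ : ℝ => μ * Real.pi) Real.pi n := by
    simpa using (hasDerivAt_id (n : ℝ)).mul_const Real.pi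
  have hnum := ((hasDerivAt_besselJ_order hx n).mul hmul.cos).sub
    ((hasDerivAt_besselJ_order hx (-n)).comp (n : ℝ) (hasDerivAt_neg (n : ℝ)))
  have hden := hmul.sin
  rw [hasDerivAt_iff_tendsto_slope] at hnum hden
  have hle : 𝓝[{μ : ℝ | ∀ n : ℤ, μ ≠ (n : ℝ)}] (n : ℝ) ≤ 𝓝[≠] (n : ℝ) :=
    nhdsWithin_mono _ fun μ hμ => by simpa using hμ n
  have h := (hnum.div hden (by simp [Real.cos_nat_mul_pi, Real.pi_ne_zero])).mono_left hle
  have hval : (besselJOrderDeriv n x + (-1) ^ n * besselJOrderDeriv (-n) x) / Real.pi =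
      (besselJOrderDeriv n x * Real.cos (n * Real.pi) +
        besselJ n x * (-Real.sin (n * Real.pi) * Real.pi) - besselJOrderDeriv (-n) x * -1) /
        (Real.cos (n * Real.pi) * Real.pi) := by
    rw [Real.cos_nat_mul_pi, Real.sin_nat_mul_pi]
    field_simp
    linear_combination besselJOrderDeriv (-n) x * hsq
  rw [hval]
  refine h.congr' ?_
  filter_upwards [self_mem_nhdsWithin] with μ hμ
  have hne : μ - n ≠ 0 := sub_ne_zero.2 (by simpa using hμ n)
  simp only [Pi.div_apply, slope_def_field, Pi.sub_apply, Pi.mul_apply, Function.comp,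
    Real.cos_nat_mul_pi, Real.sin_nat_mul_pi, besselJ_neg_natCast hx]
  rw [div_div_div_cancel_right₀ hne]
  ring_nf

theorem hasDerivAt_besselY_zero (hx : 0 < x) :
    HasDerivAt (besselY 0) (-besselY 1 x) x := by
  have h := ((hasDerivAt_besselJOrderDeriv hx 0).const_mul 2).div_const Real.pi
  have hY : besselY 0 =ᶠ[𝓝 x] fun x => 2 * besselJOrderDeriv 0 x / Real.pi := by
    filter_upwards [lt_mem_nhds hx] with t ht
    have := besselY_natCast ht 0
    simp at this
    rw [this]
    ring
  have h1 := besselY_natCast hx 1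
  have h2 := besselJOrderDeriv_sub_one hx 0
  convert! h.congr_of_eventuallyEq hY using 1
  simp at h1 h2 ⊢
  rw [h1, h2]
  field_simp
  ring

theorem hasDerivAt_besselY_natCast_succ (hx : 0 < x) (n : ℕ) :
    HasDerivAt (besselY (n + 1 : ℕ)) (besselY n x - (n + 1) / x * besselY (n + 1 : ℕ) x) x := by
  have h := ((hasDerivAt_besselJOrderDeriv hx (n + 1 : ℕ)).add
    ((hasDerivAt_besselJOrderDeriv hx (-(n + 1 : ℕ))).const_mul ((-1) ^ (n + 1)))).div_const
      Real.pi
  have hY : besselY (n + 1 : ℕ) =ᶠ[𝓝 x] fun x => (besselJOrderDeriv (n + 1 : ℕ) x +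
      (-1) ^ (n + 1) * besselJOrderDeriv (-(n + 1 : ℕ)) x) / Real.pi := by
    filter_upwards [lt_mem_nhds hx] with t ht
    exact besselY_natCast ht (n + 1)
  have h2 := besselJOrderDeriv_sub_one hx (n + 1 : ℕ)
  have hJ := besselJ_neg_natCast hx (n + 1)
  have hsq : ((-1 : ℝ) ^ n) * (-1) ^ n = 1 := by rw [← mul_pow]; simp
  convert! h.congr_of_eventuallyEq hY using 1
  rw [besselY_natCast hx, besselY_natCast hx, hJ]
  push_cast at *
  rw [show (n : ℝ) + 1 - 1 = n by ring] at h2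
  rw [show -((n : ℝ) + 1) + 1 = -n by ring, h2, pow_succ]
  field_simp
  linear_combination (-besselJ (n + 1) x) * hsq

theorem hasDerivAt_besselJ_natCast_succ (hx : 0 < x) (n : ℕ) :
    HasDerivAt (besselJ (n + 1 : ℕ))
      ((n + 1) / x * besselJ (n + 1 : ℕ) x - besselJ (n + 2 : ℕ) x) x := by
  convert hasDerivAt_besselJ hx (n + 1 : ℕ) using 3
  · push_cast; ring
  · push_cast; ring

theorem hasDerivAt_besselJ_zero (hx : 0 < x) :
    HasDerivAt (besselJ 0) (-besselJ 1 x) x := by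
  simpa using hasDerivAt_besselJ hx 0

theorem hasDerivAt_besselJ_mul_besselY_succ (hx : 0 < x) (n : ℕ) :
    HasDerivAt (fun x => besselJ (n + 1 : ℕ) x * besselY (n + 1 : ℕ) x)
      (besselJ (n + 1 : ℕ) x * besselY n x - besselJ (n + 2 : ℕ) x * besselY (n + 1 : ℕ) x) x := by
  convert! (hasDerivAt_besselJ_natCast_succ hx n).mul (hasDerivAt_besselY_natCast_succ hx n)
    using 1
  ring

theorem besselJ_natCast (n : ℕ) (x : ℝ) :
    besselJ n x = (x / 2) ^ n * besselSeries n (x ^ 2 / 4) := by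
  rw [besselJ_eq_mul_besselSeries, Real.rpow_natCast]

theorem besselY_natCast_eq (hx : 0 < x) (n : ℕ) :
    besselY n x = (2 * Real.log (x / 2) * ((x / 2) ^ n * besselSeries n (x ^ 2 / 4)) +
      (x / 2) ^ n * besselSeriesDeriv n (x ^ 2 / 4) +
      (-1) ^ n * (((x / 2) ^ n)⁻¹ * besselSeriesDeriv (-n) (x ^ 2 / 4))) / Real.pi := by
  have hsq : ((-1 : ℝ) ^ n) * (-1) ^ n = 1 := by rw [← mul_pow]; simp
  rw [besselY_natCast hx, besselJOrderDeriv, besselJOrderDeriv, besselJ_neg_natCast hx,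
    besselJ_natCast, Real.rpow_neg (half_pos hx).le, Real.rpow_natCast]
  congr 1
  linear_combination (Real.log (x / 2) * ((x / 2) ^ n * besselSeries n (x ^ 2 / 4))) * hsq

theorem continuous_besselSeries (ν : ℝ) : Continuous (besselSeries ν) :=
  continuous_iff_continuousAt.2 fun w => (hasDerivAt_besselSeries ν w).continuousAt

theorem continuous_besselSeriesDeriv (ν : ℝ) : Continuous (besselSeriesDeriv ν) :=
  continuous_iff_continuousAt.2 fun w => (hasDerivAt_besselSeriesDeriv ν w).continuousAt

theorem besselSeries_zero_right (ν : ℝ) : besselSeries ν 0 = recipGamma (ν + 1) := by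
  simp [besselSeries, alternatingExpSeries_zero]

theorem besselSeriesDeriv_zero_right (ν : ℝ) :
    besselSeriesDeriv ν 0 = deriv recipGamma (ν + 1) := by
  simp [besselSeriesDeriv, alternatingExpSeries_zero]

theorem tendsto_comp_sq_div_four {g : ℝ → ℝ} (hg : Continuous g) :
    Tendsto (fun x : ℝ => g (x ^ 2 / 4)) (𝓝[>] 0) (𝓝 (g 0)) := by
  have h : Continuous fun x : ℝ => g (x ^ 2 / 4) := by fun_prop
  simpa using (h.tendsto 0).mono_left nhdsWithin_le_nhds

theorem tendsto_half_pow_succ (n : ℕ) :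
    Tendsto (fun x : ℝ => (x / 2) ^ (n + 1)) (𝓝[>] 0) (𝓝 0) := by
  have h : Continuous fun x : ℝ => (x / 2) ^ (n + 1) := by fun_prop
  simpa using (h.tendsto 0).mono_left nhdsWithin_le_nhds

theorem tendsto_log_mul_half_pow_succ (n : ℕ) :
    Tendsto (fun x : ℝ => Real.log (x / 2) * (x / 2) ^ (n + 1)) (𝓝[>] 0) (𝓝 0) := by
  have h : Tendsto (fun x : ℝ => x / 2) (𝓝[>] 0) (𝓝[>] 0) := by
    refine tendsto_nhdsWithin_iff.2 ⟨?_, ?_⟩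
    · simpa using tendsto_half_pow_succ 0
    · filter_upwards [self_mem_nhdsWithin] with t (ht : 0 < t) using half_pos ht
  have h2 := (tendsto_log_mul_rpow_nhdsGT_zero (r := (n + 1 : ℕ)) (by positivity)).comp h
  simpa only [Function.comp_def, Real.rpow_natCast] using h2

/-- A function on `(0, ∞)` vanishing at `0⁺` is bounded by the bound on its derivative. -/
theorem abs_le_mul_of_abs_deriv_le {f f' : ℝ → ℝ} {C : ℝ} (hx : 0 < x)
    (hf : ∀ t, 0 < t → HasDerivAt f (f' t) t) (hC : ∀ t, 0 < t → t ≤ x → |f' t| ≤ C)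
    (h0 : Tendsto f (𝓝[>] 0) (𝓝 0)) : |f x| ≤ C * x := by
  have hlim : Tendsto (fun ε => |f x - f ε|) (𝓝[>] 0) (𝓝 |f x|) := by
    simpa using (h0.const_sub (f x)).abs
  refine le_of_tendsto hlim ?_
  filter_upwards [Ioo_mem_nhdsGT hx] with ε hε
  have hC0 : 0 ≤ C := (abs_nonneg _).trans (hC x hx le_rfl)
  have h := (convex_Icc ε x).norm_image_sub_le_of_norm_hasDerivWithin_le (C := C)
    (fun t ht => (hf t (hε.1.trans_le ht.1)).hasDerivWithinAt)
    (fun t ht => hC t (hε.1.trans_le ht.1) ht.2)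
    (left_mem_Icc.2 hε.2.le) (right_mem_Icc.2 hε.2.le)
  simp only [Real.norm_eq_abs] at h
  rw [abs_of_pos (sub_pos.2 hε.2)] at h
  exact h.trans (mul_le_mul_of_nonneg_left (by linarith [hε.1]) hC0)

theorem tendsto_besselJ_mul_besselY_succ (n : ℕ) :
    Tendsto (fun x => besselJ (n + 1 : ℕ) x * besselY (n + 1 : ℕ) x) (𝓝[>] 0)
      (𝓝 (-(1 / (Real.pi * (n + 1))))) := by
  have hE := tendsto_comp_sq_div_four (continuous_besselSeries (n + 1 : ℕ))
  have hG := tendsto_comp_sq_div_four (continuous_besselSeriesDeriv (n + 1 : ℕ))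
  have hG' := tendsto_comp_sq_div_four (continuous_besselSeriesDeriv (-(n + 1 : ℕ)))
  have h := (hE.mul (((((tendsto_log_mul_half_pow_succ (2 * n + 1)).const_mul 2).mul hE).add
    ((tendsto_half_pow_succ (2 * n + 1)).mul hG)).add (hG'.const_mul ((-1) ^ (n + 1))))).div_const
      Real.pi
  have e : -((n + 1 : ℕ) : ℝ) + 1 = -n := by push_cast; ring
  rw [besselSeries_zero_right, besselSeriesDeriv_zero_right, besselSeriesDeriv_zero_right, e,
    deriv_recipGamma_neg_natCast, recipGamma_natCast_add_one] at h
  have hsq : (-1 : ℝ) ^ (n + 1) * ((-1) ^ n * n.factorial) = -n.factorial := by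
    rw [pow_succ, mul_neg_one, neg_mul, ← mul_assoc, ← mul_pow]
    simp
  rw [hsq, Nat.factorial_succ] at h
  convert! h.congr' ?_ using 2
  · push_cast
    field_simp
    ring
  · filter_upwards [self_mem_nhdsWithin] with t (ht : 0 < t)
    rw [besselJ_natCast, besselY_natCast_eq ht]
    field_simp
    ring

theorem tendsto_besselJ_zero_mul_besselY_zero_sub_log :
    Tendsto (fun x => 1 / 2 * (besselJ 0 x * besselY 0 x) -
      (Real.log (x / 2) + Real.eulerMascheroniConstant) / Real.pi) (𝓝[>] 0) (𝓝 0) := by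
  have hsq : HasDerivAt (fun x : ℝ => besselSeries 0 (x ^ 2 / 4) ^ 2) 0 0 := by
    have hd : HasDerivAt (fun x : ℝ => x ^ 2 / 4) 0 0 := by
      simpa using! (hasDerivAt_pow 2 (0 : ℝ)).div_const 4
    simpa using! ((hasDerivAt_besselSeries 0 _).comp (0 : ℝ) hd).pow 2
  have h1 := recipGamma_natCast_add_one 0
  norm_num at h1
  have hslope := (hasDerivAt_iff_tendsto_slope.1 hsq).mono_left
    (nhdsWithin_mono 0 (fun t (ht : 0 < t) => ht.ne'))
  have hE := tendsto_comp_sq_div_four (continuous_besselSeries 0)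
  have hG := tendsto_comp_sq_div_four (continuous_besselSeriesDeriv 0)
  have h := (((((tendsto_log_mul_half_pow_succ 0).mul hslope).const_mul 2).add
    (hE.mul hG)).sub_const Real.eulerMascheroniConstant).div_const Real.pi
  norm_num [besselSeries_zero_right, besselSeriesDeriv_zero_right, h1,
    deriv_recipGamma_one] at h
  refine h.congr' ?_
  filter_upwards [self_mem_nhdsWithin] with t (ht : 0 < t)
  have a1 := besselJ_natCast 0 t
  have a3 := besselY_natCast_eq ht 0
  simp at a1 a3
  rw [a1, a3, slope_def_field]
  norm_num [besselSeries_zero_right, h1]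
  field_simp
  ring

/-- The Wronskian of the Bessel functions of order zero. -/
theorem besselJ_one_mul_besselY_zero_sub (hx : 0 < x) :
    besselJ 1 x * besselY 0 x - besselJ 0 x * besselY 1 x = 2 / (Real.pi * x) := by
  have hd (t : ℝ) (ht : 0 < t) : HasDerivAt (fun x =>
      x * (besselJ 1 x * besselY 0 x - besselJ 0 x * besselY 1 x) - 2 / Real.pi) 0 t := by
    have hJ := hasDerivAt_besselJ_natCast_succ ht 0
    have hY := hasDerivAt_besselY_natCast_succ ht 0
    have h2 := besselJ_sub_one ht 1
    norm_num at hJ hY h2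
    convert! ((hasDerivAt_id t).mul ((hJ.mul (hasDerivAt_besselY_zero ht)).sub
      ((hasDerivAt_besselJ_zero ht).mul hY))).sub_const (2 / Real.pi) using 1
    simp only [Pi.sub_apply, Pi.mul_apply, id]
    rw [h2]
    field_simp
    ring
  have hlim : Tendsto (fun x =>
      x * (besselJ 1 x * besselY 0 x - besselJ 0 x * besselY 1 x) - 2 / Real.pi)
      (𝓝[>] 0) (𝓝 0) := by
    have hE := tendsto_comp_sq_div_four (continuous_besselSeries 0)
    have hE' := tendsto_comp_sq_div_four (continuous_besselSeries 1)
    have hG := tendsto_comp_sq_div_four (continuous_besselSeriesDeriv 0)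
    have hG' := tendsto_comp_sq_div_four (continuous_besselSeriesDeriv 1)
    have hG'' := tendsto_comp_sq_div_four (continuous_besselSeriesDeriv (-1))
    have hy := tendsto_half_pow_succ 1
    have h := ((((hy.mul (hE'.mul hG)).const_mul 4).sub ((hy.mul (hE.mul hG')).const_mul 2)).add
      ((hE.mul hG'').const_mul 2)).div_const Real.pi |>.sub_const (2 / Real.pi)
    have h0 := deriv_recipGamma_neg_natCast 0
    have h1 := recipGamma_natCast_add_one 0
    norm_num at h0 h1
    norm_num [besselSeries_zero_right, besselSeriesDeriv_zero_right, h0, h1] at h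
    refine h.congr' ?_
    filter_upwards [self_mem_nhdsWithin] with t (ht : 0 < t)
    have a1 := besselJ_natCast 0 t
    have a2 := besselJ_natCast 1 t
    have a3 := besselY_natCast_eq ht 0
    have a4 := besselY_natCast_eq ht 1
    simp at a1 a2 a3 a4
    rw [a1, a2, a3, a4]
    field_simp
    ring
  have h := abs_le_mul_of_abs_deriv_le hx (C := 0) hd (by simp) hlim
  rw [zero_mul, abs_nonpos_iff, sub_eq_zero] at h
  field_simp at h ⊢
  linarith

/-- The difference between the partial sums of the series and the claimed value of its sum. -/
noncomputable def besselSumError (N : ℕ) (x : ℝ) : ℝ :=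
  ∑ n ∈ Finset.range N,
      (besselJ (n + 1 : ℕ) x * besselY (n + 1 : ℕ) x + 1 / (Real.pi * (n + 1))) +
    (1 / 2 * (besselJ 0 x * besselY 0 x) -
      (Real.log (x / 2) + Real.eulerMascheroniConstant) / Real.pi)

theorem besselSumError_succ (N : ℕ) (x : ℝ) :
    besselSumError (N + 1) x = besselSumError N x +
      (besselJ (N + 1 : ℕ) x * besselY (N + 1 : ℕ) x + 1 / (Real.pi * (N + 1))) := by
  rw [besselSumError, besselSumError, Finset.sum_range_succ]
  ring

theorem tendsto_besselSumError (N : ℕ) : Tendsto (besselSumError N) (𝓝[>] 0) (𝓝 0) := by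
  induction N with
  | zero =>
    convert! tendsto_besselJ_zero_mul_besselY_zero_sub_log using 2 with x
    simp [besselSumError]
  | succ N ih =>
    rw [funext (besselSumError_succ N)]
    simpa using! ih.add ((tendsto_besselJ_mul_besselY_succ N).add_const (1 / (Real.pi * (N + 1))))

theorem hasDerivAt_besselSumError (hx : 0 < x) (N : ℕ) :
    HasDerivAt (besselSumError N) (-(besselJ (N + 1 : ℕ) x * besselY N x)) x := by
  induction N with
  | zero =>
    have hlog : HasDerivAt (fun x : ℝ => Real.log (x / 2)) (1 / x) x := by
      convert! ((hasDerivAt_id x).div_const 2).log (half_pos hx).ne' using 1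
      simp
      field_simp
    have h := (((hasDerivAt_besselJ_zero hx).mul (hasDerivAt_besselY_zero hx)).const_mul
      (1 / 2)).sub ((hlog.add_const Real.eulerMascheroniConstant).div_const Real.pi)
    convert! h using 1
    · ext t
      simp [besselSumError]
    · have hW := besselJ_one_mul_besselY_zero_sub hx
      have e : 1 / x / Real.pi = (2 / (Real.pi * x)) / 2 := by field_simp
      rw [e, ← hW]
      simp
      ring
  | succ N ih =>
    convert! ih.add ((hasDerivAt_besselJ_mul_besselY_succ hx N).add_const
      (1 / (Real.pi * (N + 1)))) using 1
    · ext t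
      simp [besselSumError_succ]
    · ring

theorem abs_besselSeries_natCast_le (n : ℕ) {w W : ℝ} (hw : |w| ≤ W) :
    |besselSeries n w| ≤ (n.factorial : ℝ)⁻¹ * Real.exp W := by
  refine (abs_alternatingExpSeries_le (C := (n.factorial : ℝ)⁻¹) (fun k => ?_) w).trans ?_
  · rw [show (n : ℝ) + k + 1 = (n + k : ℕ) + 1 by push_cast; ring, recipGamma_natCast_add_one,
      abs_of_pos (by positivity)]
    gcongr
    omega
  · gcongr

theorem exists_abs_besselSeriesDeriv_natCast_le :
    ∃ B, 1 ≤ B ∧ ∀ (n : ℕ) (w W : ℝ), |w| ≤ W →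
      |besselSeriesDeriv n w| ≤ B * Real.exp W ∧
      |besselSeriesDeriv (-(n + 1 : ℕ)) w| ≤ B * n.factorial * Real.exp W := by
  obtain ⟨B, hB1, hB⟩ := exists_forall_abs_recipGamma_le 0
  refine ⟨B, hB1, fun n w W hw => ⟨?_, ?_⟩⟩
  · refine (abs_alternatingExpSeries_le (fun k => (hB _ (by positivity)).2) w).trans ?_
    gcongr
  · refine (abs_alternatingExpSeries_le (C := B * n.factorial) (fun k => ?_) w).trans ?_
    · rcases le_or_gt k n with hk | hk
      · rw [show -((n + 1 : ℕ) : ℝ) + k + 1 = -((n - k : ℕ) : ℝ) by push_cast [hk]; ring,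
          deriv_recipGamma_neg_natCast, abs_mul, abs_pow, abs_neg, abs_one, one_pow, one_mul,
          Nat.abs_cast]
        have : ((n - k).factorial : ℝ) ≤ n.factorial := by
          exact_mod_cast Nat.factorial_le (Nat.sub_le n k)
        nlinarith [n.factorial.cast_nonneg (α := ℝ)]
      · have h1 : (1 : ℝ) ≤ n.factorial := by exact_mod_cast n.factorial_pos
        have h2 : (n : ℝ) + 1 ≤ k := by exact_mod_cast hk
        refine (hB _ (by push_cast; linarith)).2.trans ?_
        nlinarith
    · gcongr

theorem mul_abs_log_le {y : ℝ} (hy : 0 < y) : y * |Real.log y| ≤ 1 + y ^ 2 := by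
  have h1 := Real.log_le_sub_one_of_pos hy
  have h2 := Real.one_sub_inv_le_log_of_pos hy
  have h3 : y * y⁻¹ = 1 := mul_inv_cancel₀ hy.ne'
  rcases abs_cases (Real.log y) with ⟨h, -⟩ | ⟨h, -⟩ <;> rw [h] <;> nlinarith

theorem exists_abs_besselJ_mul_besselY_le (hx : 0 < x) :
    ∃ C, ∀ (n : ℕ) (t : ℝ), 0 < t → t ≤ x →
      |besselJ (n + 2 : ℕ) t * besselY (n + 1 : ℕ) t| ≤ C / ((n + 1) * (n + 2)) := by
  obtain ⟨B, hB1, hB⟩ := exists_abs_besselSeriesDeriv_natCast_le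
  set Y := x / 2 with hY
  set W := x ^ 2 / 4 with hWdef
  have hW : 0 ≤ W := by positivity
  set M := 1 + Y ^ 2
  refine ⟨Real.exp W * (2 * M * (W * Real.exp W) * Real.exp W +
    Y * (W * Real.exp W) * (B * Real.exp W) + Y * (B * Real.exp W)) / Real.pi,
    fun n t ht htx => ?_⟩
  have hy : 0 < t / 2 := by positivity
  have hyY : t / 2 ≤ Y := by rw [hY]; linarith
  have hw : |t ^ 2 / 4| ≤ W := by
    rw [abs_of_nonneg (by positivity), hWdef]
    gcongr
  have hwy : (t / 2) ^ 2 = t ^ 2 / 4 := by ring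
  obtain ⟨hG, -⟩ := hB (n + 1) _ _ hw
  obtain ⟨-, hG'⟩ := hB n _ _ hw
  have hE := abs_besselSeries_natCast_le (n + 1) hw
  have hE2 := abs_besselSeries_natCast_le (n + 2) hw
  have hlog : t / 2 * |Real.log (t / 2)| ≤ M := (mul_abs_log_le hy).trans (by simp only [M]; gcongr)
  have hpow : ((t / 2) ^ 2) ^ (n + 1) ≤ n.factorial * (W * Real.exp W) := by
    have h1 : (t / 2) ^ 2 ≤ W := by rw [hwy]; exact (le_abs_self _).trans hw
    have h2 := Real.pow_div_factorial_le_exp W hW n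
    rw [div_le_iff₀ (by positivity)] at h2
    calc ((t / 2) ^ 2) ^ (n + 1) ≤ W ^ (n + 1) := by gcongr
      _ = W * W ^ n := by ring
      _ ≤ W * (Real.exp W * n.factorial) := by gcongr
      _ = _ := by ring
  have hE1 : |besselSeries (n + 1 : ℕ) (t ^ 2 / 4)| ≤ Real.exp W := by
    refine hE.trans (mul_le_of_le_one_left (Real.exp_pos _).le (inv_le_one_of_one_le₀ ?_))
    exact_mod_cast (n + 1).factorial_pos
  have key : besselJ (n + 2 : ℕ) t * besselY (n + 1 : ℕ) t =
      besselSeries (n + 2 : ℕ) (t ^ 2 / 4) *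
      (2 * (t / 2 * Real.log (t / 2)) * ((t / 2) ^ 2) ^ (n + 1) *
          besselSeries (n + 1 : ℕ) (t ^ 2 / 4) +
        t / 2 * ((t / 2) ^ 2) ^ (n + 1) * besselSeriesDeriv (n + 1 : ℕ) (t ^ 2 / 4) +
        t / 2 * ((-1) ^ (n + 1) * besselSeriesDeriv (-(n + 1 : ℕ)) (t ^ 2 / 4))) / Real.pi := by
    rw [besselJ_natCast, besselY_natCast_eq ht]
    generalize t / 2 = y at hy
    field_simp
    ring
  rw [key, abs_div, abs_of_pos Real.pi_pos, abs_mul]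
  calc _ ≤ (((n + 2).factorial : ℝ)⁻¹ * Real.exp W) *
        (2 * M * (n.factorial * (W * Real.exp W)) * Real.exp W +
          Y * (n.factorial * (W * Real.exp W)) * (B * Real.exp W) +
          Y * (B * n.factorial * Real.exp W)) / Real.pi := by
        gcongr
        refine (abs_add_three _ _ _).trans ?_
        simp only [abs_mul, abs_pow, abs_neg, abs_one, one_pow, one_mul, abs_two, abs_of_pos hy]
        gcongr
    _ = _ := by
        rw [Nat.factorial_succ, Nat.factorial_succ]
        push_cast
        field_simp
        ring

end

theorem stmt10 (x : ℝ) (hx : 0 < x) :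
    HasSum (fun n : ℕ =>
        besselJ (n + 1) x * besselY (n + 1) x + 1 / (Real.pi * (n + 1)))
      ((Real.log (x / 2) + Real.eulerMascheroniConstant) / Real.pi
        - 1 / 2 * besselJ 0 x * besselY 0 x) := by
  obtain ⟨C, hC⟩ := exists_abs_besselJ_mul_besselY_le hx
  have hC0 : 0 ≤ C := by
    have := (abs_nonneg _).trans (hC 0 x hx le_rfl)
    norm_num at this
    linarith
  have hbound (N : ℕ) : |besselSumError (N + 1) x| ≤ C * x * (1 / ((N : ℝ) + 1) ^ 2) := by
    refine (abs_le_mul_of_abs_deriv_le (C := C / (N + 1) ^ 2) hx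
      (fun t ht => hasDerivAt_besselSumError ht (N + 1)) (fun t ht htx => ?_)
      (tendsto_besselSumError (N + 1))).trans ?_
    · rw [abs_neg]
      refine (hC N t ht htx).trans ?_
      rw [sq]
      gcongr
      linarith
    · exact le_of_eq (by ring)
  have hsq : Summable fun N : ℕ => 1 / ((N : ℝ) + 1) ^ 2 := by
    simpa using (summable_nat_add_iff 1).2 (Real.summable_one_div_nat_pow.2 one_lt_two)
  have herr : Summable fun N => besselSumError N x := by
    rw [← summable_nat_add_iff 1]
    exact .of_norm_bounded (hsq.mul_left (C * x)) hbound
  have hterm (n : ℕ) : besselJ (n + 1) x * besselY (n + 1) x + 1 / (Real.pi * (n + 1)) =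
      besselSumError (n + 1) x - besselSumError n x := by
    rw [besselSumError_succ]
    push_cast
    ring
  have hsum : Summable fun n : ℕ =>
      besselJ (n + 1) x * besselY (n + 1) x + 1 / (Real.pi * (n + 1)) := by
    simp only [hterm]
    exact ((summable_nat_add_iff 1).2 herr).sub herr
  rw [hsum.hasSum_iff_tendsto_nat]
  simp only [hterm, Finset.sum_range_sub (fun n => besselSumError n x)]
  convert herr.tendsto_atTop_zero.sub_const (besselSumError 0 x) using 2
  simp [besselSumError]
  ring
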